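/- Let v_1, …, v_{n+1} ∈ ℝ^n form a regular n-simplex frame, with n ≥ 2 and d ≥ 3 such that n + d ≥ 7. Then every v_j (j = 1, …, n+1) is a robust eigenvector of F_d, where F_d(x) = Σ_{i=1}^{n+1} ⟨v_i, x⟩^{d−1} v_i, the contraction map of the regular simplex tensor T = Σ_{i=1}^{n+1} v_i^{⊗d}. -/

import Mathlib

open Filter
open scoped RealInnerProductSpace

theorem exists_forall_tendsto_of_hasFDerivAt {E : Type*} [NormedAddCommGroup E] [NormedSpace ℝ E]
    {G : E → E} {G' : E →L[ℝ] E} {w : E} (hw : G w = w) (hG : HasFDerivAt G G' w)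
    (hlt : ‖G'‖ < 1) :
    ∃ ε > (0 : ℝ), ∀ x : ℕ → E, ‖x 0 - w‖ < ε → (∀ k, x (k + 1) = G (x k)) →
      Tendsto x atTop (nhds w) := by
  obtain ⟨r, hr, hr1⟩ := exists_between hlt
  have hr0 : 0 ≤ r := (norm_nonneg _).trans hr.le
  have hev : ∀ᶠ y in nhds w, ‖G y - w‖ ≤ r * ‖y - w‖ := by
    filter_upwards [hG.isLittleO.def (sub_pos.2 hr)] with y hy
    rw [hw] at hy
    calc ‖G y - w‖ = ‖(G y - w - G' (y - w)) + G' (y - w)‖ := by rw [sub_add_cancel]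
      _ ≤ (r - ‖G'‖) * ‖y - w‖ + ‖G'‖ * ‖y - w‖ :=
        (norm_add_le _ _).trans (add_le_add hy (G'.le_opNorm _))
      _ = r * ‖y - w‖ := by ring
  obtain ⟨ε, hε, hball⟩ := Metric.eventually_nhds_iff.1 hev
  refine ⟨ε, hε, fun x hx0 hx => ?_⟩
  have hbound : ∀ k, ‖x k - w‖ ≤ r ^ k * ‖x 0 - w‖ := by
    intro k
    induction k with
    | zero => simp
    | succ k ih =>
      have hk : dist (x k) w < ε := by
        rw [dist_eq_norm]
        exact (ih.trans (mul_le_of_le_one_left (norm_nonneg _)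
          (pow_le_one₀ hr0 hr1.le))).trans_lt hx0
      rw [hx, pow_succ']
      calc _ ≤ r * ‖x k - w‖ := hball hk
        _ ≤ r * (r ^ k * ‖x 0 - w‖) := by gcongr
        _ = _ := by ring
  refine tendsto_iff_norm_sub_tendsto_zero.2 (squeeze_zero (fun _ => norm_nonneg _) hbound ?_)
  simpa using (tendsto_pow_atTop_nhds_zero_of_lt_one hr0 hr1).mul_const ‖x 0 - w‖

theorem mul_add_one_lt_pow {n m : ℕ} (hn : 2 ≤ n) (hm : 2 ≤ m) (hnm : 6 ≤ n + m) :
    m * (n + 1) + 1 < n ^ m := by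
  have step : ∀ a b : ℕ, 1 ≤ a → a * (n + 1) + 1 < n ^ a → a ≤ b → b * (n + 1) + 1 < n ^ b := by
    intro a b ha h hab
    induction b, hab using Nat.le_induction with
    | base => exact h
    | succ b hab ih =>
      calc (b + 1) * (n + 1) + 1 ≤ (b * (n + 1) + 1) * 2 := by nlinarith
        _ < n ^ b * 2 := by omega
        _ ≤ n ^ (b + 1) := by rw [pow_succ]; gcongr
  rcases (by omega : n = 2 ∨ n = 3 ∨ 4 ≤ n) with rfl | rfl | h4
  · exact step 4 m (by norm_num) (by norm_num) (by omega)
  · exact step 3 m (by norm_num) (by norm_num) (by omega)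
  · exact step 2 m (by norm_num) (by nlinarith) hm

theorem hasFDerivAt_inv_norm_smul_self {E : Type*} [NormedAddCommGroup E] [InnerProductSpace ℝ E]
    {w : E} (hw : ‖w‖ = 1) {c : ℝ} (hc : 0 < c) :
    HasFDerivAt (fun z : E => ‖z‖⁻¹ • z)
      (c⁻¹ • (ContinuousLinearMap.id ℝ E - (innerSL ℝ w).smulRight w)) (c • w) := by
  have hn : ‖c • w‖ = c := by simp [norm_smul, hw, hc.le]
  have h1 := (hasStrictFDerivAt_norm_sq (c • w)).hasFDerivAt
  have h2 := h1.sqrt (by rw [hn]; positivity)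
  simp only [Real.sqrt_sq (norm_nonneg _), hn] at h2
  have h3 := ((hasDerivAt_inv (x := ‖c • w‖) (by rw [hn]; exact hc.ne')).comp_hasFDerivAt _ h2).smul
    (hasFDerivAt_id (c • w))
  refine h3.congr_fderiv ?_
  ext h
  simp only [one_div, id_eq, Function.comp_apply, hn, Real.sqrt_sq hc.le, mul_inv, map_smul,
    smul_apply, add_apply, sub_apply, ContinuousLinearMap.id_apply,
    ContinuousLinearMap.smulRight_apply, innerSL_apply_apply, smul_eq_mul, nsmul_eq_mul]
  match_scalars
  · rfl
  · field_simp

section frame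
variable {n : ℕ} {v : Fin (n + 1) → EuclideanSpace ℝ (Fin n)}

theorem sum_simplex_eq_zero (hn : n ≠ 0) (hunit : ∀ i, ‖v i‖ = 1)
    (hsimplex : ∀ i k : Fin (n + 1), i ≠ k → ⟪v i, v k⟫ = -(1 / (n : ℝ))) :
    ∑ i, v i = 0 := by
  have key : ∀ j, ∑ i, ⟪v i, v j⟫ = 0 := by
    intro j
    rw [← Finset.add_sum_erase _ _ (Finset.mem_univ j),
      Finset.sum_congr rfl fun i hi => hsimplex i j (Finset.ne_of_mem_erase hi)]
    simp [hunit, hn]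
  rw [← inner_self_eq_zero (𝕜 := ℝ), inner_sum]
  simp [sum_inner, key]

theorem sum_pow_inner_smul (hunit : ∀ i, ‖v i‖ = 1)
    (hsimplex : ∀ i k : Fin (n + 1), i ≠ k → ⟪v i, v k⟫ = -(1 / (n : ℝ)))
    (m : ℕ) (j : Fin (n + 1)) {M : Type*} [AddCommGroup M] [Module ℝ M] (u : Fin (n + 1) → M) :
    ∑ i, ⟪v i, v j⟫ ^ m • u i =
      (1 - (-(1 / (n : ℝ))) ^ m) • u j + (-(1 / (n : ℝ))) ^ m • ∑ i, u i := by
  rw [← Finset.add_sum_erase _ _ (Finset.mem_univ j),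
    Finset.sum_congr rfl fun i hi => by rw [hsimplex i j (Finset.ne_of_mem_erase hi)],
    ← Finset.smul_sum, ← Finset.add_sum_erase _ u (Finset.mem_univ j)]
  simp only [real_inner_self_eq_norm_sq, hunit]
  module

theorem span_simplex (hn : n ≠ 0) (hunit : ∀ i, ‖v i‖ = 1)
    (hsimplex : ∀ i k : Fin (n + 1), i ≠ k → ⟪v i, v k⟫ = -(1 / (n : ℝ))) :
    Submodule.span ℝ (Set.range v) = ⊤ := by
  have hli : LinearIndependent ℝ fun i : Fin n => v i.castSucc := by
    rw [Fintype.linearIndependent_iff]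
    intro a ha k
    have h1 : ∑ i, a i = 0 := by
      have := congrArg (fun y => ⟪y, v (Fin.last n)⟫) ha
      simp only [sum_inner, inner_smul_left, inner_zero_left,
        fun i : Fin n => hsimplex i.castSucc (Fin.last n) (Fin.castSucc_ne_last i),
        ← Finset.sum_mul] at this
      simpa [hn] using this
    have h2 := congrArg (fun y => ⟪y, v k.castSucc⟫) ha
    have h3 : ∀ i : Fin n, ⟪v i.castSucc, v k.castSucc⟫ =
        -(1 / (n : ℝ)) + if i = k then 1 + 1 / (n : ℝ) else 0 := by
      intro i
      split_ifs with h
      · simp [h, hunit]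
      · simp [hsimplex i.castSucc k.castSucc (by simpa using h)]
    simp only [sum_inner, inner_smul_left, inner_zero_left, h3, mul_add, Finset.sum_add_distrib,
      mul_ite, mul_zero, Finset.sum_ite_eq', Finset.mem_univ, if_true, conj_trivial] at h2
    rw [← Finset.sum_mul, h1, zero_mul, zero_add, ← mul_add] at h2
    exact (mul_eq_zero.1 h2).resolve_right (by positivity)
  have : NeZero n := ⟨hn⟩
  have h := hli.span_eq_top_of_card_eq_finrank (by simp)
  rw [eq_top_iff, ← h]
  exact Submodule.span_mono (Set.range_comp_subset_range _ _)

theorem sum_inner_smul_simplex (hn : n ≠ 0) (hunit : ∀ i, ‖v i‖ = 1)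
    (hsimplex : ∀ i k : Fin (n + 1), i ≠ k → ⟪v i, v k⟫ = -(1 / (n : ℝ)))
    (h : EuclideanSpace ℝ (Fin n)) :
    ∑ i, ⟪v i, h⟫ • v i = (1 + 1 / (n : ℝ)) • h := by
  have hmem : h ∈ Submodule.span ℝ (Set.range v) := by
    rw [span_simplex hn hunit hsimplex]; trivial
  induction hmem using Submodule.span_induction with
  | mem x hx =>
    obtain ⟨j, rfl⟩ := hx
    have := sum_pow_inner_smul hunit hsimplex 1 j v
    simpa [sum_simplex_eq_zero hn hunit hsimplex] using this
  | zero => simp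
  | add x y _ _ hx hy =>
    simp only [inner_add_right, add_smul, Finset.sum_add_distrib, hx, hy, smul_add]
  | smul a x _ hx =>
    simp only [inner_smul_right, mul_smul, ← Finset.smul_sum, hx]
    rw [smul_comm]

end frame

theorem hasFDerivAt_sum_pow_inner_smul {ι E : Type*} [Fintype ι] [NormedAddCommGroup E]
    [InnerProductSpace ℝ E] (v : ι → E) (m : ℕ) (w : E) :
    HasFDerivAt (fun x => ∑ i, ⟪v i, x⟫ ^ m • v i)
      (∑ i, (m * ⟪v i, w⟫ ^ (m - 1)) • (innerSL ℝ (v i)).smulRight (v i)) w := by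
  refine HasFDerivAt.fun_sum fun i _ => ?_
  have := (((innerSL ℝ (v i)).hasFDerivAt (x := w)).pow m).smul_const (v i)
  refine this.congr_fderiv ?_
  ext h
  simp [mul_smul]

theorem norm_sub_inner_smul_le {E : Type*} [NormedAddCommGroup E] [InnerProductSpace ℝ E]
    {w : E} (hw : ‖w‖ = 1) (h : E) : ‖h - ⟪w, h⟫ • w‖ ≤ ‖h‖ := by
  refine le_of_sq_le_sq ?_ (norm_nonneg h)
  rw [norm_sub_sq_real, norm_smul, inner_smul_right, real_inner_comm, hw, mul_one, Real.norm_eq_abs,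
    sq_abs]
  nlinarith [sq_nonneg ⟪w, h⟫]

theorem abs_simplex_multiplier_lt_one {n p : ℕ} (hn : 2 ≤ n) (hp : 1 ≤ p) (hnp : 5 ≤ n + p) :
    0 < 1 - (-(1 / (n : ℝ))) ^ (p + 1) ∧
    |(1 - (-(1 / (n : ℝ))) ^ (p + 1))⁻¹ *
      ((p + 1 : ℕ) * ((-(1 / (n : ℝ))) ^ p * (1 + 1 / (n : ℝ))))| < 1 := by
  have hn0 : (0 : ℝ) < n := by positivity
  set s : ℝ := (1 / (n : ℝ)) ^ (p + 1) with hs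
  have hs0 : 0 < s := by positivity
  have hns : (n : ℝ) ^ (p + 1) * s = 1 := by
    rw [hs, ← mul_pow, mul_one_div_cancel hn0.ne', one_pow]
  have hlt : ((p + 1 : ℕ) : ℝ) * (n + 1) * s + s < 1 := by
    have : (((p + 1) * (n + 1) + 1 : ℕ) : ℝ) < ((n ^ (p + 1) : ℕ) : ℝ) :=
      Nat.cast_lt.2 (mul_add_one_lt_pow hn (by omega) (by omega))
    push_cast at this ⊢
    nlinarith [mul_lt_mul_of_pos_right this hs0]
  have habs : |(-(1 / (n : ℝ))) ^ (p + 1)| = s := by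
    rw [abs_pow, abs_neg, abs_of_pos (by positivity : (0 : ℝ) < 1 / n)]
  have hle := (le_abs_self ((-(1 / (n : ℝ))) ^ (p + 1))).trans_eq habs
  have hpos : 0 < 1 - (-(1 / (n : ℝ))) ^ (p + 1) := by
    have : 0 ≤ ((p + 1 : ℕ) : ℝ) * (n + 1) * s := by positivity
    linarith
  refine ⟨hpos, ?_⟩
  rw [abs_mul, abs_inv, abs_of_pos hpos, inv_mul_lt_one₀ hpos, abs_mul, abs_mul, abs_pow, abs_neg,
    abs_of_pos (by positivity : (0 : ℝ) < 1 / n), abs_of_pos (by positivity : (0 : ℝ) < 1 + 1 / n),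
    Nat.abs_cast]
  have hst : (1 / (n : ℝ)) ^ p * (1 + 1 / (n : ℝ)) = (n + 1) * s := by
    rw [hs, pow_succ]
    field_simp
  rw [hst]
  linarith

/-- For a regular `n`-simplex frame `v_1, …, v_{n+1}` in `ℝ^n` with
`n ≥ 2`, `d ≥ 3` and `n + d ≥ 7`, every frame vector `v j` is a robust eigenvector of
the tensor power method for the regular simplex tensor `T = ∑ i, (v i)^{⊗d}`. -/
theorem regular_simplex_frame_vectors_robust {n : ℕ} (hn : 2 ≤ n) (d : ℕ) (hd : 3 ≤ d)
    (hnd : 7 ≤ n + d)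
    (v : Fin (n + 1) → EuclideanSpace ℝ (Fin n))
    (hunit : ∀ i, ‖v i‖ = 1)
    (hsimplex : ∀ i k : Fin (n + 1), i ≠ k → ⟪v i, v k⟫ = -(1 / (n : ℝ))) :
    ∀ j : Fin (n + 1), ∃ ε > (0 : ℝ), ∀ x : ℕ → EuclideanSpace ℝ (Fin n),
      ‖x 0 - v j‖ < ε →
      (∀ k : ℕ, x (k + 1) =
        ‖∑ i, ((⟪v i, x k⟫ : ℝ) ^ (d - 1)) • v i‖⁻¹ •
          (∑ i, ((⟪v i, x k⟫ : ℝ) ^ (d - 1)) • v i)) →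
      Tendsto x atTop (nhds (v j)) := by
  intro j
  obtain ⟨p, rfl⟩ : ∃ p, d = p + 2 := ⟨d - 2, by omega⟩
  have hn0 : n ≠ 0 := by omega
  obtain ⟨hpos, hlt⟩ := abs_simplex_multiplier_lt_one (p := p) hn (by omega) (by omega)
  have hF : ∑ i, ⟪v i, v j⟫ ^ (p + 1) • v i = (1 - (-(1 / (n : ℝ))) ^ (p + 1)) • v j := by
    rw [sum_pow_inner_smul hunit hsimplex, sum_simplex_eq_zero hn0 hunit hsimplex, smul_zero,
      add_zero]
  have hN := hasFDerivAt_inv_norm_smul_self (hunit j) hpos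
  rw [← hF] at hN
  refine exists_forall_tendsto_of_hasFDerivAt ?_
    (hN.comp (v j) (hasFDerivAt_sum_pow_inner_smul v (p + 1) (v j))) ?_
  · simp only [Function.comp_apply, hF, norm_smul, hunit, mul_one, Real.norm_eq_abs,
      abs_of_pos hpos, smul_smul, inv_mul_cancel₀ hpos.ne', one_smul]
  · refine (ContinuousLinearMap.opNorm_le_bound _ (abs_nonneg _) fun h => ?_).trans_lt hlt
    have hF' : (∑ i, (((p + 1 : ℕ) : ℝ) * ⟪v i, v j⟫ ^ (p + 1 - 1)) •
        (innerSL ℝ (v i)).smulRight (v i)) h = ((p + 1 : ℕ) : ℝ) •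
          ((1 - (-(1 / (n : ℝ))) ^ p) • ⟪v j, h⟫ • v j +
            (-(1 / (n : ℝ))) ^ p • (1 + 1 / (n : ℝ)) • h) := by
      rw [← sum_inner_smul_simplex hn0 hunit hsimplex h,
        ← sum_pow_inner_smul hunit hsimplex p j fun i => ⟪v i, h⟫ • v i]
      simp only [sum_apply, smul_apply,
        ContinuousLinearMap.smulRight_apply, innerSL_apply_apply, Finset.smul_sum, mul_smul,
        Nat.add_sub_cancel]
    have hG : ∀ a b : ℝ, a • ⟪v j, h⟫ • v j + b • h -
        ⟪v j, a • ⟪v j, h⟫ • v j + b • h⟫ • v j = b • (h - ⟪v j, h⟫ • v j) := by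
      intro a b
      simp only [inner_add_right, inner_smul_right, real_inner_self_eq_norm_sq, hunit]
      module
    rw [ContinuousLinearMap.comp_apply, hF']
    simp only [smul_apply, sub_apply,
      ContinuousLinearMap.id_apply, ContinuousLinearMap.smulRight_apply, innerSL_apply_apply,
      inner_smul_right (𝕜 := ℝ) (v j) _ ((p + 1 : ℕ) : ℝ)]
    rw [mul_smul, ← smul_sub, smul_smul (_ ^ p) (1 + 1 / (n : ℝ)) h, hG, smul_smul, smul_smul,
      norm_smul, Real.norm_eq_abs, mul_assoc]
    gcongr
    exact norm_sub_inner_smul_le (hunit j) h
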